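/- For every c ∈ (1,2) and ε ∈ (0, min{1/4, 2−c}) there exists C > 0 such that for every j ∈ ℕ and all real λ, ξ with |λ| > 2^{(ε−c)j} or |ξ| > 2^{(2ε−1)j}, we have |∫_ℝ e^{2πi(λ|t|^c − ξt)} ψ_j(t) dt| ≤ C · 2^{−εj/2}. -/

import Mathlib

open MeasureTheory

/-- `e x = e^{2πix}` -/
noncomputable def e (x : ℝ) : ℂ := Complex.exp (2 * Real.pi * Complex.I * x)

/-- The smooth dyadic piece `ψ_j(x) = (φ(2^{-j}x) - φ(2^{-j+1}x))/x` of the kernel `1/x`. -/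
noncomputable def psi (φ : ℝ → ℝ) (j : ℕ) (x : ℝ) : ℝ :=
  (φ ((2 : ℝ) ^ (-(j : ℝ)) * x) - φ ((2 : ℝ) ^ (-(j : ℝ) + 1) * x)) / x

open Set

lemma norm_e_aux (x : ℝ) : ‖e x‖ = 1 := by
  unfold e
  have : (2 * Real.pi * Complex.I * x : ℂ) = ((2 * Real.pi * x : ℝ) : ℂ) * Complex.I := by
    push_cast; ring
  rw [this, Complex.norm_exp_ofReal_mul_I]

lemma e_neg_aux (x : ℝ) : e (-x) = (starRingEnd ℂ) (e x) := by
  unfold e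
  rw [← Complex.exp_conj]
  simp only [map_mul, Complex.conj_I, Complex.conj_ofReal, map_ofNat]
  push_cast
  congr 1
  ring

lemma continuous_e_aux : Continuous e := by
  unfold e; fun_prop

lemma hasDerivAt_e_aux {p : ℝ → ℝ} {p' x : ℝ} (h : HasDerivAt p p' x) :
    HasDerivAt (fun s => e (p s)) (e (p x) * (2 * Real.pi * Complex.I * p')) x := by
  unfold e
  exact ((h.ofReal_comp).const_mul (2 * Real.pi * Complex.I : ℂ)).cexp

lemma vdc1 (p p' p'' : ℝ → ℝ) (a b μ : ℝ) (hab : a ≤ b)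
    (hp : ∀ x ∈ Icc a b, HasDerivAt p (p' x) x)
    (hp' : ∀ x ∈ Icc a b, HasDerivAt p' (p'' x) x)
    (hc : ContinuousOn p'' (Icc a b)) (h2 : ∀ x ∈ Icc a b, 0 ≤ p'' x)
    (hμ : 0 < μ) (h1 : ∀ x ∈ Icc a b, μ ≤ |p' x|) :
    ‖∫ x in a..b, e (p x)‖ ≤ 1 / μ := by
  have hu : uIcc a b = Icc a b := uIcc_of_le hab
  have hne : ∀ x ∈ Icc a b, p' x ≠ 0 := fun x hx h0 => by
    have := h1 x hx; rw [h0, abs_zero] at this; linarith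
  have hpi : (2 * Real.pi * Complex.I : ℂ) ≠ 0 := by
    simp [Real.pi_ne_zero]
  have cp : ContinuousOn p (Icc a b) := fun x hx => (hp x hx).continuousAt.continuousWithinAt
  have cp' : ContinuousOn p' (Icc a b) := fun x hx => (hp' x hx).continuousAt.continuousWithinAt
  have ce : ContinuousOn (fun x => e (p x)) (Icc a b) := continuous_e_aux.comp_continuousOn cp
  have cq : ContinuousOn (fun x => p'' x / (p' x)^2) (Icc a b) :=
    hc.div (cp'.pow 2) (fun x hx => pow_ne_zero 2 (hne x hx))
  have cr : ContinuousOn (fun x => e (p x) * ((p'' x / (p' x)^2 : ℝ) : ℂ) / (2 * Real.pi * Complex.I))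
      (Icc a b) :=
    (ce.mul (Complex.continuous_ofReal.comp_continuousOn cq)).div_const _
  have hd : ∀ x ∈ uIcc a b, HasDerivAt (fun s => e (p s) * (((p' s)⁻¹ : ℝ) : ℂ) / (2 * Real.pi * Complex.I))
      (e (p x) - e (p x) * ((p'' x / (p' x)^2 : ℝ) : ℂ) / (2 * Real.pi * Complex.I)) x := by
    intro x hx
    rw [hu] at hx
    have hn := hne x hx
    have hn' : (p' x : ℂ) ≠ 0 := by exact_mod_cast hn
    have := ((hasDerivAt_e_aux (hp x hx)).mul ((hp' x hx).inv hn).ofReal_comp).div_const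
      (2 * Real.pi * Complex.I : ℂ)
    refine HasDerivAt.congr_deriv this ?_
    simp only [Pi.inv_apply]
    push_cast
    field_simp
    ring
  have key := intervalIntegral.integral_eq_sub_of_hasDerivAt hd
    ((ce.sub cr).intervalIntegrable_of_Icc hab)
  rw [intervalIntegral.integral_sub (ce.intervalIntegrable_of_Icc hab)
    (cr.intervalIntegrable_of_Icc hab)] at key
  have hd2 : ∀ x ∈ uIcc a b, HasDerivAt (fun s => -(p' s)⁻¹) (p'' x / (p' x)^2) x := by
    intro x hx
    rw [hu] at hx
    have := ((hp' x hx).inv (hne x hx)).neg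
    refine HasDerivAt.congr_deriv this ?_
    ring
  have key2 := intervalIntegral.integral_eq_sub_of_hasDerivAt hd2
    (cq.intervalIntegrable_of_Icc hab)
  have hinv : ∀ x ∈ Icc a b, |(p' x)⁻¹| ≤ 1 / μ := by
    intro x hx
    rw [abs_inv, ← one_div]
    exact one_div_le_one_div_of_le hμ (h1 x hx)
  have hnpi : ‖(2 * Real.pi * Complex.I : ℂ)‖ = 2 * Real.pi := by
    simp [abs_of_pos Real.pi_pos]
  have hint : ‖∫ x in a..b, e (p x) * ((p'' x / (p' x)^2 : ℝ) : ℂ) / (2 * Real.pi * Complex.I)‖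
      ≤ (2 / μ) / (2 * Real.pi) := by
    have := intervalIntegral.norm_integral_le_of_norm_le (a := a) (b := b) (μ := volume)
      (f := fun x => e (p x) * ((p'' x / (p' x)^2 : ℝ) : ℂ) / (2 * Real.pi * Complex.I))
      (g := fun x => (p'' x / (p' x)^2) / (2 * Real.pi)) hab
      (Filter.Eventually.of_forall (fun x hx => by
        have hx' := Ioc_subset_Icc_self hx
        rw [norm_div, norm_mul, norm_e_aux, hnpi, one_mul, Complex.norm_real, Real.norm_eq_abs,
          abs_of_nonneg (div_nonneg (h2 x hx') (sq_nonneg _))]))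
      ((cq.div_const _).intervalIntegrable_of_Icc hab)
    refine this.trans ?_
    rw [intervalIntegral.integral_div, key2]
    have h3 := abs_le.1 (hinv a ⟨le_rfl, hab⟩)
    have h4 := abs_le.1 (hinv b ⟨hab, le_rfl⟩)
    have : 2 / μ = 1 / μ + 1 / μ := by ring
    rw [this]
    gcongr
    linarith
  have hb : ∀ x ∈ Icc a b, ‖e (p x) * (((p' x)⁻¹ : ℝ) : ℂ) / (2 * Real.pi * Complex.I)‖
      ≤ (1 / μ) / (2 * Real.pi) := by
    intro x hx
    rw [norm_div, norm_mul, norm_e_aux, hnpi, one_mul, Complex.norm_real, Real.norm_eq_abs]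
    have := hinv x hx
    gcongr
  rw [sub_eq_iff_eq_add] at key
  rw [key]
  refine (norm_add_le _ _).trans ?_
  have htri := norm_sub_le (e (p b) * (((p' b)⁻¹ : ℝ) : ℂ) / (2 * Real.pi * Complex.I))
    (e (p a) * (((p' a)⁻¹ : ℝ) : ℂ) / (2 * Real.pi * Complex.I))
  have := hb a ⟨le_rfl, hab⟩
  have := hb b ⟨hab, le_rfl⟩
  have h5 : (1 / μ) / (2 * Real.pi) + (1 / μ) / (2 * Real.pi) + (2 / μ) / (2 * Real.pi)
      = (1 / μ) * (2 / Real.pi) := by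
    field_simp; ring
  have h6 : (1 / μ) * (2 / Real.pi) ≤ (1 / μ) * 1 := by
    gcongr
    rw [div_le_one Real.pi_pos]
    exact Real.two_le_pi
  linarith

lemma triv_bound (p : ℝ → ℝ) (a b : ℝ) (hab : a ≤ b) : ‖∫ x in a..b, e (p x)‖ ≤ b - a := by
  have := intervalIntegral.norm_integral_le_of_norm_le_const (a := a) (b := b)
    (f := fun x => e (p x)) (C := 1) (fun x _ => (norm_e_aux _).le)
  rwa [one_mul, abs_of_nonneg (by linarith)] at this

/-- growth of the first derivative -/
lemma growth (p' p'' : ℝ → ℝ) (a b ν : ℝ)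
    (hp' : ∀ x ∈ Icc a b, HasDerivAt p' (p'' x) x) (h2 : ∀ x ∈ Icc a b, ν ≤ p'' x) :
    ∀ x ∈ Icc a b, ∀ y ∈ Icc a b, x ≤ y → ν * (y - x) ≤ p' y - p' x := by
  refine (convex_Icc a b).mul_sub_le_image_sub_of_le_deriv
    (fun x hx => (hp' x hx).continuousAt.continuousWithinAt)
    (fun x hx => (hp' x (interior_subset hx)).differentiableAt.differentiableWithinAt) ?_
  intro x hx
  rw [(hp' x (interior_subset hx)).deriv]
  exact h2 x (interior_subset hx)

lemma vdc2 (p p' p'' : ℝ → ℝ) (a b δ : ℝ) (hab : a ≤ b)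
    (hp : ∀ x ∈ Icc a b, HasDerivAt p (p' x) x)
    (hp' : ∀ x ∈ Icc a b, HasDerivAt p' (p'' x) x)
    (hc : ContinuousOn p'' (Icc a b)) (hδ : 0 < δ) (h2 : ∀ x ∈ Icc a b, 1 / δ ^ 2 ≤ p'' x) :
    ‖∫ x in a..b, e (p x)‖ ≤ 4 * δ := by
  have cp : ContinuousOn p (Icc a b) := fun x hx => (hp x hx).continuousAt.continuousWithinAt
  have cp' : ContinuousOn p' (Icc a b) := fun x hx => (hp' x hx).continuousAt.continuousWithinAt
  have ce : ContinuousOn (fun x => e (p x)) (Icc a b) := continuous_e_aux.comp_continuousOn cp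
  have gr := growth p' p'' a b _ hp' h2
  have h0 : ∀ x ∈ Icc a b, 0 ≤ p'' x := fun x hx => le_trans (by positivity) (h2 x hx)
  have split : ∀ u v w, a ≤ u → u ≤ v → v ≤ w → w ≤ b →
      ‖∫ x in u..w, e (p x)‖ ≤ ‖∫ x in u..v, e (p x)‖ + ‖∫ x in v..w, e (p x)‖ := by
    intro u v w h1 h2 h3 h4
    rw [← intervalIntegral.integral_add_adjacent_intervals (a := u) (b := v) (c := w)]
    · exact norm_add_le _ _
    · exact (ce.mono (Icc_subset_Icc h1 (h3.trans h4))).intervalIntegrable_of_Icc h2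
    · exact (ce.mono (Icc_subset_Icc (h1.trans h2) h4)).intervalIntegrable_of_Icc h3
  have far : ∀ u v, a ≤ u → u ≤ v → v ≤ b → (∀ x ∈ Icc u v, 1 / δ ≤ |p' x|) →
      ‖∫ x in u..v, e (p x)‖ ≤ δ := by
    intro u v h1 h3 h4 h5
    have hs : Icc u v ⊆ Icc a b := Icc_subset_Icc h1 h4
    have := vdc1 p p' p'' u v (1 / δ) h3 (fun x hx => hp x (hs hx)) (fun x hx => hp' x (hs hx))
      (hc.mono hs) (fun x hx => h0 x (hs hx)) (by positivity) h5
    simpa using this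
  have hdd : 1 / δ ^ 2 * δ = 1 / δ := by field_simp
  have right : ∀ u, a ≤ u → u ≤ b → 0 ≤ p' u → ‖∫ x in u..b, e (p x)‖ ≤ 2 * δ := by
    intro u h1 h3 h4
    by_cases hs : b - u ≤ δ
    · have := triv_bound p u b h3
      linarith
    · push Not at hs
      have t1 := split u (u + δ) b h1 (by linarith) (by linarith) le_rfl
      have t2 := triv_bound p u (u + δ) (by linarith)
      have t3 := far (u + δ) b (by linarith) (by linarith) le_rfl (fun x hx => by
        have := gr u ⟨h1, h3⟩ x ⟨by linarith [hx.1], hx.2⟩ (by linarith [hx.1])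
        have h6 : 1 / δ ^ 2 * δ ≤ 1 / δ ^ 2 * (x - u) := by
          gcongr; linarith [hx.1]
        exact le_trans (by linarith) (le_abs_self _))
      linarith
  have left : ∀ u, a ≤ u → u ≤ b → p' u ≤ 0 → ‖∫ x in a..u, e (p x)‖ ≤ 2 * δ := by
    intro u h1 h3 h4
    by_cases hs : u - a ≤ δ
    · have := triv_bound p a u h1
      linarith
    · push Not at hs
      have t1 := split a (u - δ) u le_rfl (by linarith) (by linarith) h3
      have t2 := triv_bound p (u - δ) u (by linarith)
      have t3 := far a (u - δ) le_rfl (by linarith) (by linarith) (fun x hx => by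
        have := gr x ⟨hx.1, by linarith [hx.2]⟩ u ⟨h1, h3⟩ (by linarith [hx.2])
        have h6 : 1 / δ ^ 2 * δ ≤ 1 / δ ^ 2 * (u - x) := by
          gcongr; linarith [hx.2]
        exact le_trans (by linarith) (neg_le_abs _))
      linarith
  by_cases ha : 0 ≤ p' a
  · linarith [right a le_rfl hab ha]
  by_cases hb : p' b ≤ 0
  · linarith [left b hab le_rfl hb]
  push Not at ha hb
  obtain ⟨z, hz, hz0⟩ := intermediate_value_Icc hab cp' ⟨ha.le, hb.le⟩
  linarith [right z hz.1 hz.2 hz0.ge, left z hz.1 hz.2 hz0.le, split a z b le_rfl hz.1 hz.2 le_rfl]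

lemma phase_bound_pos (c : ℝ) (hc1 : 1 < c) (hc2 : c < 2) (L Ξ X u : ℝ) (hX : 1 ≤ X) (hL : 0 ≤ L)
    (h : X < L ∨ X ^ 2 < |Ξ|) (hu1 : 1/8 ≤ u) (hu2 : u ≤ 1) :
    ‖∫ s in (1/8 : ℝ)..u, e (L * s ^ c - Ξ * s)‖ ≤ (4 / √(c * (c - 1)) + 2) / √X := by
  have hX0 : 0 < X := by linarith
  have hsX : 0 < √X := Real.sqrt_pos.2 hX0
  have hcc : 0 < c * (c - 1) := mul_pos (by linarith) (by linarith)
  have hp : ∀ x ∈ Icc (1/8) u, HasDerivAt (fun s : ℝ => L * s ^ c - Ξ * s)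
      (L * (c * x ^ (c - 1)) - Ξ) x := by
    intro x hx
    have hx0 : x ≠ 0 := by linarith [hx.1]
    have := ((Real.hasDerivAt_rpow_const (x := x) (p := c) (Or.inl hx0)).const_mul L).sub
      ((hasDerivAt_id x).const_mul Ξ)
    rw [mul_one] at this
    exact this
  have hp' : ∀ x ∈ Icc (1/8) u, HasDerivAt (fun s : ℝ => L * (c * s ^ (c - 1)) - Ξ)
      (L * (c * ((c - 1) * x ^ (c - 1 - 1)))) x := by
    intro x hx
    have hx0 : x ≠ 0 := by linarith [hx.1]
    exact (((Real.hasDerivAt_rpow_const (x := x) (p := c - 1) (Or.inl hx0)).const_mul c).const_mul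
      L).sub_const Ξ
  have hcont : ContinuousOn (fun x : ℝ => L * (c * ((c - 1) * x ^ (c - 1 - 1)))) (Icc (1/8) u) := by
    intro x hx
    have hx0 : x ≠ 0 := by linarith [hx.1]
    have := Real.continuousAt_rpow_const x (c - 1 - 1) (Or.inl hx0)
    exact (ContinuousAt.mul continuousAt_const (continuousAt_const.mul
      (continuousAt_const.mul this))).continuousWithinAt
  by_cases hLX : X < L
  · set δ := 1 / √(X * (c * (c - 1))) with hδ
    have hpos : 0 < X * (c * (c - 1)) := by positivity
    have hδ0 : 0 < δ := by positivity
    have hδ2 : 1 / δ ^ 2 = X * (c * (c - 1)) := by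
      rw [hδ, div_pow, Real.sq_sqrt hpos.le]; simp
    have := vdc2 _ _ _ (1/8) u δ hu1 hp hp' hcont hδ0 (fun x hx => by
      rw [hδ2]
      have h1 : 1 ≤ x ^ (c - 1 - 1) := Real.one_le_rpow_of_pos_of_le_one_of_nonpos
        (by linarith [hx.1]) (hx.2.trans hu2) (by linarith)
      calc X * (c * (c - 1)) ≤ L * (c * (c - 1)) := by gcongr
        _ = L * (c * ((c - 1) * 1)) := by ring
        _ ≤ _ := by
          have : 0 ≤ c - 1 := by linarith
          gcongr)
    refine this.trans ?_
    rw [hδ, Real.sqrt_mul hX0.le]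
    have : 4 * (1 / (√X * √(c * (c - 1)))) = (4 / √(c * (c - 1))) / √X := by
      field_simp
    rw [this]
    gcongr
    linarith
  · have hΞ := h.resolve_left hLX
    push Not at hLX
    have goal2 : ‖∫ s in (1/8 : ℝ)..u, e (L * s ^ c - Ξ * s)‖ ≤ 2 / √X := by
      by_cases hXc : X < 4
      · have := triv_bound (fun s => L * s ^ c - Ξ * s) (1/8) u hu1
        have h2 : √X ≤ 2 := by
          rw [Real.sqrt_le_left (by norm_num)]; linarith
        have : 1 ≤ 2 / √X := by rwa [le_div_iff₀ hsX, one_mul]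
        linarith
      · push Not at hXc
        have := vdc1 _ _ _ (1/8) u (X ^ 2 / 2) hu1 hp hp' hcont (fun x hx => by
          have : 0 ≤ c - 1 := by linarith
          have : 0 ≤ x := by linarith [hx.1]
          positivity) (by positivity) (fun x hx => by
            have hx0 : 0 ≤ x := by linarith [hx.1]
            have h1 : x ^ (c - 1) ≤ 1 := Real.rpow_le_one hx0 (hx.2.trans hu2) (by linarith)
            have h0 : 0 ≤ x ^ (c - 1) := Real.rpow_nonneg hx0 _
            have h3 : L * (c * x ^ (c - 1)) ≤ X * (2 * 1) := by gcongr
            have h4 : 0 ≤ L * (c * x ^ (c - 1)) := by positivity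
            have h5 : |Ξ| - |L * (c * x ^ (c - 1))| ≤ |L * (c * x ^ (c - 1)) - Ξ| := by
              rw [abs_sub_comm]; exact abs_sub_abs_le_abs_sub _ _
            rw [abs_of_nonneg h4] at h5
            nlinarith)
        refine this.trans ?_
        rw [one_div, inv_div]
        gcongr
        rw [Real.sqrt_le_left (by positivity)]
        nlinarith [pow_le_pow_right₀ hX (show 1 ≤ 4 by norm_num)]
    refine goal2.trans ?_
    gcongr
    have : 0 ≤ 4 / √(c * (c - 1)) := by positivity
    linarith

lemma phase_bound (c : ℝ) (hc1 : 1 < c) (hc2 : c < 2) (L Ξ X u : ℝ) (hX : 1 ≤ X)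
    (h : X < |L| ∨ X ^ 2 < |Ξ|) (hu1 : 1/8 ≤ u) (hu2 : u ≤ 1) :
    ‖∫ s in (1/8 : ℝ)..u, e (L * s ^ c - Ξ * s)‖ ≤ (4 / √(c * (c - 1)) + 2) / √X := by
  rcases le_total 0 L with hL | hL
  · rw [abs_of_nonneg hL] at h
    exact phase_bound_pos c hc1 hc2 L Ξ X u hX hL h hu1 hu2
  · rw [abs_of_nonpos hL, ← abs_neg Ξ] at h
    have := phase_bound_pos c hc1 hc2 (-L) (-Ξ) X u hX (by linarith) h hu1 hu2
    have h2 : ∀ s : ℝ, e (-L * s ^ c - -Ξ * s) = (starRingEnd ℂ) (e (L * s ^ c - Ξ * s)) := by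
      intro s
      rw [← e_neg_aux]; congr 1; ring
    simp_rw [h2] at this
    rw [intervalIntegral.intervalIntegral_conj, RCLike.norm_conj] at this
    exact this

/-- insertion of an amplitude vanishing at the endpoints -/
lemma ampl (p A A' : ℝ → ℝ) (a b K M : ℝ) (hab : a ≤ b) (hp : Continuous p)
    (hA : ∀ x ∈ Icc a b, HasDerivAt A (A' x) x) (hA' : ContinuousOn A' (Icc a b))
    (hM : ∀ x ∈ Icc a b, |A' x| ≤ M) (hb : A b = 0) (hK0 : 0 ≤ K)
    (hK : ∀ u ∈ Icc a b, ‖∫ s in a..u, e (p s)‖ ≤ K) :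
    ‖∫ s in a..b, e (p s) * (A s : ℂ)‖ ≤ K * M * (b - a) := by
  have ce : Continuous (fun x => e (p x)) := continuous_e_aux.comp hp
  have key := intervalIntegral.integral_deriv_mul_eq_sub (a := a) (b := b)
    (u := fun u => ∫ s in a..u, e (p s)) (u' := fun s => e (p s))
    (v := fun s => (A s : ℂ)) (v' := fun s => (A' s : ℂ))
    (fun x _ => (ce.integral_hasStrictDerivAt a x).hasDerivAt)
    (fun x hx => (hA x (by rwa [uIcc_of_le hab] at hx)).ofReal_comp)
    (ce.intervalIntegrable _ _)
    ((Complex.continuous_ofReal.comp_continuousOn hA').intervalIntegrable_of_Icc hab)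
  have cA : ContinuousOn (fun s => (A s : ℂ)) (Icc a b) := fun x hx =>
    (hA x hx).ofReal_comp.continuousAt.continuousWithinAt
  have cI : Continuous (fun u => ∫ s in a..u, e (p s)) :=
    continuous_iff_continuousAt.2 fun x => (ce.integral_hasStrictDerivAt a x).hasDerivAt.continuousAt
  have key2 := intervalIntegral.integral_add (μ := volume)
    ((ce.continuousOn.mul cA).intervalIntegrable_of_Icc hab)
    ((cI.continuousOn.mul
      (Complex.continuous_ofReal.comp_continuousOn hA')).intervalIntegrable_of_Icc hab)
  simp only [Pi.mul_apply, Function.comp_apply] at key2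
  rw [key2] at key
  simp only [hb, Complex.ofReal_zero, mul_zero, intervalIntegral.integral_same, zero_mul,
    sub_zero] at key
  rw [eq_neg_of_add_eq_zero_left key, norm_neg]
  have := intervalIntegral.norm_integral_le_of_norm_le_const (a := a) (b := b)
    (f := fun x => (∫ s in a..x, e (p s)) * (A' x : ℂ)) (C := K * M) (fun x hx => by
      rw [uIoc_of_le hab] at hx
      have hx' := Ioc_subset_Icc_self hx
      rw [norm_mul, Complex.norm_real, Real.norm_eq_abs]
      exact mul_le_mul (hK x hx') (hM x hx') (abs_nonneg _) hK0)
  rwa [abs_of_nonneg (by linarith)] at this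

theorem stmt4 (c ε : ℝ) (hc1 : 1 < c) (hc2 : c < 2)
    (hε1 : 0 < ε) (hε2 : ε < min (1/4) (2 - c))
    (φ : ℝ → ℝ) (hφsmooth : ContDiff ℝ (⊤ : ℕ∞) φ) (hφeven : ∀ x, φ (-x) = φ x)
    (hφlb : ∀ x, Set.indicator (Set.Icc (-(1/4) : ℝ) (1/4)) 1 x ≤ φ x)
    (hφub : ∀ x, φ x ≤ Set.indicator (Set.Icc (-(1/2) : ℝ) (1/2)) 1 x) :
    ∃ C > (0 : ℝ), ∀ (j : ℕ) (lam ξ : ℝ),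
      ((2 : ℝ) ^ ((ε - c) * (j : ℝ)) < |lam| ∨
       (2 : ℝ) ^ ((2 * ε - 1) * (j : ℝ)) < |ξ|) →
      ‖∫ t : ℝ, e (lam * |t| ^ c - ξ * t) * (psi φ j t : ℂ)‖ ≤
        C * (2 : ℝ) ^ (-(ε / 2) * (j : ℝ)) := by
  have one_of : ∀ x, |x| ≤ 1/4 → φ x = 1 := by
    intro x hx
    rw [abs_le] at hx
    have h1 := hφlb x
    have h2 := hφub x
    rw [Set.indicator_of_mem (by exact ⟨hx.1, hx.2⟩)] at h1
    rw [Set.indicator_of_mem (by constructor <;> linarith)] at h2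
    exact le_antisymm h2 h1
  have zero_of : ∀ x, 1/2 < |x| → φ x = 0 := by
    intro x hx
    have h1 := hφlb x
    have h2 := hφub x
    rw [Set.indicator_of_notMem (fun h => by have := abs_le.2 h; linarith)] at h1
    rw [Set.indicator_of_notMem (fun h => by have := abs_le.2 h; linarith)] at h2
    exact le_antisymm h2 h1
  set A : ℝ → ℝ := fun x => (φ x - φ (2 * x)) / x with hAdef
  have hpsi0 : ∀ (j : ℕ) (s : ℝ), psi φ j ((2 : ℝ) ^ (j : ℝ) * s) = ((2 : ℝ) ^ (j : ℝ))⁻¹ * A s := by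
    intro j s
    have hj : (0 : ℝ) < (2 : ℝ) ^ (j : ℝ) := by positivity
    have e1 : (2 : ℝ) ^ (-(j : ℝ)) * ((2 : ℝ) ^ (j : ℝ) * s) = s := by
      rw [Real.rpow_neg (by norm_num)]; field_simp
    have e2 : (2 : ℝ) ^ (-(j : ℝ) + 1) * ((2 : ℝ) ^ (j : ℝ) * s) = 2 * s := by
      rw [Real.rpow_add (by norm_num), Real.rpow_neg (by norm_num), Real.rpow_one]; field_simp
    unfold psi
    rw [e1, e2, hAdef]
    simp only [div_eq_mul_inv, mul_inv]
    ring
  have hAneg : ∀ s, A (-s) = - A s := by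
    intro s
    simp only [hAdef]
    rw [mul_neg, hφeven, hφeven, div_neg]
  have hAsmall : ∀ s, |s| ≤ 1/8 → A s = 0 := by
    intro s hs
    simp only [hAdef]
    rw [one_of s (by linarith), one_of (2 * s) (by rw [abs_mul, abs_two]; linarith)]
    simp
  have hAbig : ∀ s, 1/2 < |s| → A s = 0 := by
    intro s hs
    simp only [hAdef]
    rw [zero_of s (by linarith), zero_of (2 * s) (by rw [abs_mul, abs_two]; linarith)]
    simp
  have hφd : Differentiable ℝ φ := hφsmooth.differentiable (by simp)
  have hφc : Continuous (deriv φ) := hφsmooth.continuous_deriv (by simp)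
  set A' : ℝ → ℝ := fun x => ((deriv φ x - deriv φ (2 * x) * 2) * x - (φ x - φ (2 * x))) / x ^ 2
    with hA'def
  have hA : ∀ x ∈ Set.Icc (1/8 : ℝ) 1, HasDerivAt A (A' x) x := by
    intro x hx
    have hx0 : x ≠ 0 := by linarith [hx.1]
    have h2 : HasDerivAt (fun x : ℝ => 2 * x) 2 x := by
      simpa using (hasDerivAt_id x).const_mul (2 : ℝ)
    have h3 : HasDerivAt (fun x : ℝ => φ (2 * x)) (deriv φ (2 * x) * 2) x :=
      (hφd (2 * x)).hasDerivAt.comp x h2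
    have := ((hφd x).hasDerivAt.sub h3).div (hasDerivAt_id x) hx0
    have h4 : A' x = ((deriv φ x - deriv φ (2 * x) * 2) * id x -
        (φ - fun x => φ (2 * x)) x * 1) / (id x) ^ 2 := by
      simp [hA'def]
    rw [h4]
    exact this
  have hA'c : ContinuousOn A' (Set.Icc (1/8 : ℝ) 1) := by
    have hφc0 := hφd.continuous
    refine ContinuousOn.div (Continuous.continuousOn (by fun_prop)) (by fun_prop) ?_
    intro x hx
    have hx0 : x ≠ 0 := by linarith [hx.1]
    positivity
  obtain ⟨M, hM⟩ := isCompact_Icc.exists_bound_of_continuousOn hA'c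
  have hM0 : 0 ≤ M := (norm_nonneg _).trans (hM 1 ⟨by norm_num, le_rfl⟩)
  set K := 4 / √(c * (c - 1)) + 2 with hK
  have hK0 : 0 < K := by positivity
  have half : ∀ L Ξ X : ℝ, 1 ≤ X → (X < |L| ∨ X ^ 2 < |Ξ|) →
      ‖∫ s in (1/8 : ℝ)..1, e (L * |s| ^ c - Ξ * s) * (A s : ℂ)‖ ≤ K / √X * M := by
    intro L Ξ X hX h
    have hcp : Continuous (fun s : ℝ => L * |s| ^ c - Ξ * s) := by
      have : Continuous (fun s : ℝ => |s| ^ c) :=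
        continuous_abs.rpow_const (fun _ => Or.inr (by linarith))
      fun_prop
    have := ampl (fun s => L * |s| ^ c - Ξ * s) A A' (1/8) 1 (K / √X) M (by norm_num) hcp hA hA'c hM
      (hAbig 1 (by norm_num)) (by positivity) (fun u hu => by
        have := phase_bound c hc1 hc2 L Ξ X u hX h hu.1 hu.2
        convert this using 2
        refine intervalIntegral.integral_congr (fun s hs => ?_)
        rw [Set.uIcc_of_le hu.1] at hs
        rw [abs_of_nonneg (by linarith [hs.1])])
    refine this.trans ?_
    have h7 : 0 ≤ K / √X * M := by positivity
    nlinarith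
  refine ⟨2 * K * M + 1, by positivity, ?_⟩
  intro j lam ξ h
  set J : ℝ := (2 : ℝ) ^ (j : ℝ) with hJ
  have hJ0 : 0 < J := by positivity
  set X : ℝ := (2 : ℝ) ^ (ε * (j : ℝ)) with hXdef
  have hX1 : 1 ≤ X := Real.one_le_rpow (by norm_num) (by positivity)
  set L := lam * (2 : ℝ) ^ (c * (j : ℝ)) with hL
  set Ξ := ξ * J with hΞ
  have hLΞ : X < |L| ∨ X ^ 2 < |Ξ| := by
    rcases h with h | h
    · left
      have hpos : (0 : ℝ) < (2 : ℝ) ^ (c * (j : ℝ)) := by positivity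
      rw [hL, abs_mul, abs_of_pos hpos]
      have := mul_lt_mul_of_pos_right h hpos
      rw [← Real.rpow_add (by norm_num)] at this
      rwa [show (ε - c) * (j : ℝ) + c * (j : ℝ) = ε * (j : ℝ) by ring] at this
    · right
      rw [hΞ, abs_mul, abs_of_pos hJ0]
      have := mul_lt_mul_of_pos_right h hJ0
      rw [hJ, ← Real.rpow_add (by norm_num)] at this
      rw [hXdef, ← Real.rpow_natCast, ← Real.rpow_mul (by norm_num)]
      rwa [show (2 * ε - 1) * (j : ℝ) + (j : ℝ) = ε * (j : ℝ) * ((2 : ℕ) : ℝ) by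
        push_cast; ring] at this
  have hscale : ∫ t : ℝ, e (lam * |t| ^ c - ξ * t) * (psi φ j t : ℂ) =
      ∫ s : ℝ, e (L * |s| ^ c - Ξ * s) * (A s : ℂ) := by
    have h1 := Measure.integral_comp_mul_left
      (fun t : ℝ => e (lam * |t| ^ c - ξ * t) * (psi φ j t : ℂ)) J
    have h2 : ∀ s : ℝ, e (lam * |J * s| ^ c - ξ * (J * s)) * (psi φ j (J * s) : ℂ) =
        (J⁻¹ : ℝ) • (e (L * |s| ^ c - Ξ * s) * (A s : ℂ)) := by
      intro s
      rw [hpsi0 j s, abs_mul, abs_of_pos hJ0, Real.mul_rpow hJ0.le (abs_nonneg _)]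
      have : J ^ c = (2 : ℝ) ^ (c * (j : ℝ)) := by
        rw [hJ, ← Real.rpow_mul (by norm_num), mul_comm]
      rw [this, ← mul_assoc lam, ← mul_assoc ξ, Complex.real_smul]
      push_cast
      ring
    simp_rw [h2] at h1
    rw [integral_smul, abs_of_pos (by positivity)] at h1
    exact (smul_right_injective ℂ (inv_ne_zero hJ0.ne') h1).symm
  rw [hscale]
  set G : ℝ → ℂ := fun s => e (L * |s| ^ c - Ξ * s) * (A s : ℂ) with hG
  have hsupp : Function.support G ⊆ Set.Ioc (-1) 1 := by
    intro s hs
    by_contra hcon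
    apply hs
    have : 1/2 < |s| := by
      by_contra h3
      push Not at h3
      rw [abs_le] at h3
      exact hcon ⟨by linarith, by linarith⟩
    simp only [hG]
    rw [hAbig s this]; simp
  rw [← intervalIntegral.integral_eq_integral_of_support_subset hsupp]
  have hcp : ∀ Ξ : ℝ, Continuous (fun s : ℝ => e (L * |s| ^ c - Ξ * s)) := by
    intro Ξ
    have : Continuous (fun s : ℝ => |s| ^ c) :=
      continuous_abs.rpow_const (fun _ => Or.inr (by linarith))
    exact continuous_e_aux.comp (by fun_prop)
  have cA : ContinuousOn (fun s => (A s : ℂ)) (Set.Icc (1/8) 1) := fun x hx =>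
    (hA x hx).ofReal_comp.continuousAt.continuousWithinAt
  have i3 : IntervalIntegrable G volume (1/8) 1 :=
    (((hcp Ξ).continuousOn).mul cA).intervalIntegrable_of_Icc (by norm_num)
  have hGneg : ∀ s, G (-s) = -(e (L * |s| ^ c - (-Ξ) * s) * (A s : ℂ)) := by
    intro s
    simp only [hG]
    rw [hAneg, abs_neg]
    push_cast
    rw [show L * |s| ^ c - Ξ * -s = L * |s| ^ c - (-Ξ) * s by ring]
    ring
  have i1' : IntervalIntegrable (fun s => G (-s)) volume (1/8) 1 := by
    simp_rw [hGneg]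
    exact ((((hcp (-Ξ)).continuousOn).mul cA).neg).intervalIntegrable_of_Icc (by norm_num)
  have i1 : IntervalIntegrable G volume (-1) (-(1/8)) := by
    have := ((IntervalIntegrable.iff_comp_neg (f := fun s => G (-s))).1 i1').symm
    simpa using this
  have hmid : ∀ s ∈ Set.uIcc (-(1/8) : ℝ) (1/8), G s = 0 := by
    intro s hs
    rw [Set.uIcc_of_le (by norm_num)] at hs
    simp only [hG]
    rw [hAsmall s (abs_le.2 hs)]; simp
  have i2 : IntervalIntegrable G volume (-(1/8)) (1/8) :=
    (intervalIntegrable_const (c := (0 : ℂ))).congr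
      (fun s hs => (hmid s (Set.uIoc_subset_uIcc hs)).symm)
  rw [← intervalIntegral.integral_add_adjacent_intervals (i1.trans i2) i3,
    ← intervalIntegral.integral_add_adjacent_intervals i1 i2,
    intervalIntegral.integral_congr (g := fun _ => (0 : ℂ)) hmid,
    intervalIntegral.integral_zero, add_zero]
  have hneg : ∫ s in (-1 : ℝ)..(-(1/8)), G s =
      -∫ s in (1/8 : ℝ)..1, e (L * |s| ^ c - (-Ξ) * s) * (A s : ℂ) := by
    rw [← intervalIntegral.integral_comp_neg (fun s => G s), ← intervalIntegral.integral_neg]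
    simp_rw [hGneg]
  rw [hneg]
  have b1 := half L Ξ X hX1 hLΞ
  have b2 := half L (-Ξ) X hX1 (by rwa [abs_neg])
  refine (norm_add_le _ _).trans ?_
  rw [norm_neg]
  have hfin : (2 : ℝ) ^ (-(ε / 2) * (j : ℝ)) = 1 / √X := by
    rw [Real.sqrt_eq_rpow, hXdef, ← Real.rpow_mul (by norm_num), one_div, ← Real.rpow_neg (by norm_num)]
    congr 1; ring
  rw [hfin]
  have : 0 ≤ 1 / √X := by positivity
  have e3 : K / √X * M = K * M * (1 / √X) := by ring
  rw [e3] at b1 b2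
  nlinarith
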